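/- arXiv:1707.03732 — 7 statements merged into one kernel-verified Lean document; each statement's English description precedes it below -/
import Mathlib

section
/- For each n ≥ 2, the commutative square formed by right multiplication ρ_a : R → R (r ↦ r·a), the projections η_{n−1} : R → M_{n−1} and η_n : R → M_n, and the map ψ_{n−1,n} : M_{n−1} → M_n is a pushout of left R-modules: for every left R-module X and homomorphisms f : R → X and g : M_{n−1} → X with g ∘ η_{n−1} = f ∘ ρ_a, there exists a unique R-module homomorphism h : M_n → X with h ∘ η_n = f and h ∘ ψ_{n−1,n} = g. -/
/-- The transition map `ψ_{i,ℓ} : R/Ra^i → R/Ra^ℓ`, `r + Ra^i ↦ r·a^{ℓ-i} + Ra^ℓ`. -/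
def psi {R : Type*} [Ring R] (a : R) (i ℓ : ℕ) (h : i ≤ ℓ) :
    (R ⧸ Submodule.span R {a ^ i}) →ₗ[R] (R ⧸ Submodule.span R {a ^ ℓ}) :=
  Submodule.liftQ _
    ((Submodule.span R {a ^ ℓ}).mkQ ∘ₗ LinearMap.toSpanSingleton R R (a ^ (ℓ - i)))
    (by
      rw [Submodule.span_le]
      rintro x hx
      rw [Set.mem_singleton_iff] at hx
      subst hx
      simp only [SetLike.mem_coe, LinearMap.mem_ker, LinearMap.comp_apply,
        LinearMap.toSpanSingleton_apply, Submodule.mkQ_apply,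
        Submodule.Quotient.mk_eq_zero, smul_eq_mul]
      rw [← pow_add, Nat.add_sub_cancel' h]
      exact Submodule.mem_span_singleton_self _)

/-- For each `n ≥ 2`, the commutative square formed by right multiplication
`ρ_a : R → R` (`r ↦ r·a`), the projections `η_{n−1} : R → M_{n−1}` and `η_n : R → M_n`, and the
map `ψ_{n−1,n} : M_{n−1} → M_n` is a pushout of left `R`-modules: for every left `R`-module `X`
and homomorphisms `f : R → X` and `g : M_{n−1} → X` with `g ∘ η_{n−1} = f ∘ ρ_a`, there exists
a unique `R`-module homomorphism `h : M_n → X` with `h ∘ η_n = f` and `h ∘ ψ_{n−1,n} = g`. -/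
theorem stmt_2 {R : Type*} [Ring R] [Nontrivial R] (a : R)
    (h1 : ∀ r : R, r * a = 0 → r = 0)
    (h2 : Submodule.span R {a} ≠ (⊤ : Submodule R R))
    (n : ℕ) (hn : 2 ≤ n) :
    (Submodule.span R {a ^ n}).mkQ ∘ₗ LinearMap.toSpanSingleton R R a =
      psi a (n - 1) n (Nat.sub_le n 1) ∘ₗ (Submodule.span R {a ^ (n - 1)}).mkQ ∧
    ∀ (X : Type*) [AddCommGroup X] [Module R X]
      (f : R →ₗ[R] X) (g : (R ⧸ Submodule.span R {a ^ (n - 1)}) →ₗ[R] X),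
      g ∘ₗ (Submodule.span R {a ^ (n - 1)}).mkQ = f ∘ₗ LinearMap.toSpanSingleton R R a →
      ∃! h : (R ⧸ Submodule.span R {a ^ n}) →ₗ[R] X,
        h ∘ₗ (Submodule.span R {a ^ n}).mkQ = f ∧
        h ∘ₗ psi a (n - 1) n (Nat.sub_le n 1) = g := by
  have hsq : (Submodule.span R {a ^ n}).mkQ ∘ₗ LinearMap.toSpanSingleton R R a =
      psi a (n - 1) n (Nat.sub_le n 1) ∘ₗ (Submodule.span R {a ^ (n - 1)}).mkQ := by
    have e : n - (n - 1) = 1 := by omega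
    unfold psi
    rw [Submodule.liftQ_mkQ, e, pow_one]
  refine ⟨hsq, ?_⟩
  intro X _ _ f g hfg
  have hf : Submodule.span R {a ^ n} ≤ LinearMap.ker f := by
    rw [Submodule.span_le, Set.singleton_subset_iff, SetLike.mem_coe, LinearMap.mem_ker]
    have h := LinearMap.congr_fun hfg (a ^ (n - 1))
    have hz : (Submodule.span R {a ^ (n - 1)}).mkQ (a ^ (n - 1)) = 0 := by
      rw [Submodule.mkQ_apply, Submodule.Quotient.mk_eq_zero]
      exact Submodule.mem_span_singleton_self _
    rw [LinearMap.comp_apply, LinearMap.comp_apply, hz, map_zero,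
      LinearMap.toSpanSingleton_apply, smul_eq_mul, ← pow_succ,
      Nat.sub_add_cancel (by omega)] at h
    exact h.symm
  refine ⟨Submodule.liftQ _ f hf, ⟨Submodule.liftQ_mkQ _ _ _, ?_⟩, ?_⟩
  · apply Submodule.linearMap_qext
    rw [LinearMap.comp_assoc, ← hsq, ← LinearMap.comp_assoc, Submodule.liftQ_mkQ, hfg]
  · rintro h ⟨hh, -⟩
    apply Submodule.linearMap_qext
    rw [hh, Submodule.liftQ_mkQ]
end

section
/- Let n ≥ 1. Assume that M_1 = R/R·a is a simple left R-module and that, for each 1 ≤ i < n, there is no element x ∈ M_i with a·x = 1 + R·a^i. Then M_n is a uniserial left R-module of length n: its submodules are exactly the n+1 terms of the chain 0 < Im(ψ_{1,n}) < Im(ψ_{2,n}) < ⋯ < Im(ψ_{n−1,n}) < M_n, so in particular M_n has a unique composition series. -/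
theorem aux_pow_cancel {R : Type*} [Ring R] (a : R)
    (h1 : ∀ r : R, r * a = 0 → r = 0) (k : ℕ) (x y : R) (h : x * a ^ k = y * a ^ k) : x = y := by
  induction k with
  | zero => simpa using h
  | succ k ih =>
    apply ih
    rw [pow_succ, ← mul_assoc, ← mul_assoc] at h
    have := h1 (x * a ^ k - y * a ^ k) (by rw [sub_mul, h, sub_self])
    exact sub_eq_zero.mp this

theorem aux_mem_range {R : Type*} [Ring R] (a : R) (i n : ℕ) (h : i ≤ n) (x : R) :
    (Submodule.Quotient.mk x : R ⧸ Submodule.span R {a ^ n}) ∈ LinearMap.range (psi a i n h) ↔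
      ∃ r : R, r * a ^ (n - i) = x := by
  constructor
  · rintro ⟨y, hy⟩
    obtain ⟨y, rfl⟩ := Submodule.Quotient.mk_surjective _ y
    have hy' : (Submodule.Quotient.mk (y * a ^ (n - i)) : R ⧸ Submodule.span R {a ^ n})
      = Submodule.Quotient.mk x := hy
    rw [Submodule.Quotient.eq, Submodule.mem_span_singleton] at hy'
    obtain ⟨s, hs⟩ := hy'
    refine ⟨y - s * a ^ i, ?_⟩
    rw [sub_mul, mul_assoc, ← pow_add, Nat.add_sub_cancel' h]
    rw [smul_eq_mul] at hs
    rw [hs]; abel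
  · rintro ⟨r, rfl⟩
    exact ⟨Submodule.Quotient.mk r, rfl⟩

theorem aux_ideals {R : Type*} [Ring R] (a : R)
    (h1 : ∀ r : R, r * a = 0 → r = 0) (n : ℕ)
    (hmax : IsCoatom (Submodule.span R {a} : Submodule R R))
    (hnosol : ∀ i : ℕ, 1 ≤ i → i < n → ∀ x r : R, 1 - a * x ≠ r * a ^ i)
    (m : ℕ) (hm : m ≤ n) : ∀ J : Submodule R R, a ^ m ∈ J →
      ∃ k ≤ m, ∀ x, x ∈ J ↔ ∃ r, r * a ^ k = x := by
  induction m with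
  | zero =>
    intro J hJ
    refine ⟨0, le_rfl, fun x => ⟨fun _ => ⟨x, by simp⟩, fun _ => ?_⟩⟩
    simpa using J.smul_mem x hJ
  | succ m ih =>
    intro J hJ
    obtain ⟨k, hk, hk'⟩ := ih (by omega) (J.comap (LinearMap.toSpanSingleton R R a))
      (by simpa [pow_succ] using hJ)
    simp only [Submodule.mem_comap, LinearMap.toSpanSingleton_apply, smul_eq_mul] at hk'
    by_cases hle : J ≤ Submodule.span R {a}
    · refine ⟨k + 1, by omega, fun x => ⟨fun hx => ?_, ?_⟩⟩
      · obtain ⟨y, rfl⟩ := Submodule.mem_span_singleton.mp (hle hx)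
        obtain ⟨r, hr⟩ := (hk' y).mp hx
        exact ⟨r, by rw [pow_succ, ← mul_assoc, hr, smul_eq_mul]⟩
      · rintro ⟨r, rfl⟩
        rw [pow_succ, ← mul_assoc]
        exact (hk' _).mpr ⟨r, rfl⟩
    · have htop : Submodule.span R {a} ⊔ J = ⊤ := hmax.2 _ (left_lt_sup.mpr hle)
      have h1m : (1 : R) ∈ Submodule.span R {a} ⊔ J := htop ▸ Submodule.mem_top
      obtain ⟨y, hy, j, hj, hyj⟩ := Submodule.mem_sup.mp h1m
      obtain ⟨x, rfl⟩ := Submodule.mem_span_singleton.mp hy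
      rw [smul_eq_mul] at hyj
      have haj : (1 - a * x) * a ∈ J := by
        have h := J.smul_mem a hj
        rw [smul_eq_mul, eq_sub_of_add_eq' hyj] at h
        convert h using 1
        noncomm_ring
      obtain ⟨r, hr⟩ := (hk' _).mp haj
      have hk0 : k = 0 := by
        by_contra hne
        exact hnosol k (by omega) (by omega) x r hr.symm
      subst hk0
      have hone : (1 : R) ∈ J := by
        rw [← hyj]
        exact J.add_mem ((hk' x).mpr ⟨x, by simp⟩) hj
      refine ⟨0, by omega, fun x => ⟨fun _ => ⟨x, by simp⟩, fun _ => ?_⟩⟩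
      simpa using J.smul_mem x hone

/-- Let `n ≥ 1`. Assume that `M_1 = R/R·a` is a simple left `R`-module and that,
for each `1 ≤ i < n`, there is no element `x ∈ M_i` with `a·x = 1 + R·a^i`. Then `M_n` is a
uniserial left `R`-module of length `n`: its submodules are exactly the `n+1` terms of the
chain `0 < Im(ψ_{1,n}) < ⋯ < Im(ψ_{n−1,n}) < M_n` (here `Im(ψ_{0,n}) = 0` and
`Im(ψ_{n,n}) = M_n`), so in particular `M_n` has a unique composition series. -/
theorem stmt_3 {R : Type*} [Ring R] [Nontrivial R] (a : R)
    (h1 : ∀ r : R, r * a = 0 → r = 0)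
    (h2 : Submodule.span R {a} ≠ (⊤ : Submodule R R))
    (n : ℕ) (hn : 1 ≤ n)
    (hsimple : IsSimpleModule R (R ⧸ Submodule.span R {a}))
    (hnosol : ∀ i : ℕ, 1 ≤ i → i < n →
      ¬∃ x : R ⧸ Submodule.span R {a ^ i},
        a • x = (Submodule.Quotient.mk 1 : R ⧸ Submodule.span R {a ^ i})) :
    (∀ N : Submodule R (R ⧸ Submodule.span R {a ^ n}),
        ∃ (i : ℕ) (h : i ≤ n), N = LinearMap.range (psi a i n h)) ∧
    ∀ (i j : ℕ) (hi : i ≤ n) (hj : j ≤ n), i < j →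
      LinearMap.range (psi a i n hi) < LinearMap.range (psi a j n hj) := by
  have hmax : IsCoatom (Submodule.span R {a} : Submodule R R) :=
    isSimpleModule_iff_isCoatom.mp hsimple
  constructor
  · intro N
    obtain ⟨k, hk, hk'⟩ := aux_ideals a h1 n hmax
      (fun i hi hin x r hx => hnosol i hi hin ⟨Submodule.Quotient.mk x, by
        rw [← Submodule.Quotient.mk_smul, eq_comm, Submodule.Quotient.eq,
          Submodule.mem_span_singleton]
        exact ⟨r, hx.symm⟩⟩) n le_rfl (N.comap (Submodule.mkQ _))
      (by
        rw [Submodule.mem_comap, Submodule.mkQ_apply,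
          (Submodule.Quotient.mk_eq_zero _).mpr (Submodule.mem_span_singleton_self _)]
        exact N.zero_mem)
    refine ⟨n - k, by omega, ?_⟩
    ext x
    obtain ⟨x, rfl⟩ := Submodule.Quotient.mk_surjective _ x
    rw [aux_mem_range, Nat.sub_sub_self hk]
    exact hk' x
  · intro i j hi hj hij
    refine lt_of_le_not_ge ?_ ?_
    · intro x hx
      obtain ⟨x, rfl⟩ := Submodule.Quotient.mk_surjective _ x
      rw [aux_mem_range] at hx ⊢
      obtain ⟨r, rfl⟩ := hx
      refine ⟨r * a ^ (j - i), ?_⟩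
      rw [mul_assoc, ← pow_add]
      congr 2
      omega
    · intro hle
      have h := hle ((aux_mem_range a j n hj (a ^ (n - j))).mpr ⟨1, one_mul _⟩)
      rw [aux_mem_range] at h
      obtain ⟨r, hr⟩ := h
      have e : n - i = (j - i - 1) + 1 + (n - j) := by omega
      rw [e, pow_add, ← mul_assoc] at hr
      have h3 := aux_pow_cancel a h1 (n - j) _ 1 (by rw [hr, one_mul])
      apply h2
      rw [eq_top_iff]
      intro x _
      rw [Submodule.mem_span_singleton]
      refine ⟨x * (r * a ^ (j - i - 1)), ?_⟩
      rw [smul_eq_mul, mul_assoc, mul_assoc, ← pow_succ, h3, mul_one]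
end

section
/- Let n ≥ 1. Assume that M_1 = R/R·a is a simple left R-module and that, for each 1 ≤ i < n, there is no element x ∈ M_i with a·x = 1 + R·a^i. Then every composition factor of M_n is isomorphic to M_1; that is, setting Im(ψ_{0,n}) := 0 and Im(ψ_{n,n}) := M_n, one has Im(ψ_{i+1,n})/Im(ψ_{i,n}) ≅ R/R·a as left R-modules for every 0 ≤ i ≤ n−1. -/
theorem psi_mk_aux {R : Type*} [Ring R] (a : R) (i l : ℕ) (h : i ≤ l) (r : R) :
    psi a i l h (Submodule.Quotient.mk r) = Submodule.Quotient.mk (r * a ^ (l - i)) := rfl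

theorem cancel_aux {R : Type*} [Ring R] (a : R) (h1 : ∀ r : R, r * a = 0 → r = 0) (k : ℕ) :
    ∀ r : R, r * a ^ k = 0 → r = 0 := by
  induction k with
  | zero => intro r h; simpa using h
  | succ k ih =>
    intro r h
    rw [pow_succ, ← mul_assoc] at h
    exact ih r (h1 _ h)

/-- Let `n ≥ 1`. Assume that `M_1 = R/R·a` is a simple left `R`-module and that,
for each `1 ≤ i < n`, there is no element `x ∈ M_i` with `a·x = 1 + R·a^i`. Then every
composition factor of `M_n` is isomorphic to `M_1`: for every `0 ≤ i ≤ n−1`,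
`Im(ψ_{i+1,n})/Im(ψ_{i,n}) ≅ R/R·a` as left `R`-modules (note `Im(ψ_{0,n}) = 0` and
`Im(ψ_{n,n}) = M_n` for the map `ψ` as defined above). -/
theorem stmt_4 {R : Type*} [Ring R] [Nontrivial R] (a : R)
    (h1 : ∀ r : R, r * a = 0 → r = 0)
    (h2 : Submodule.span R {a} ≠ (⊤ : Submodule R R))
    (n : ℕ) (hn : 1 ≤ n)
    (hsimple : IsSimpleModule R (R ⧸ Submodule.span R {a}))
    (hnosol : ∀ i : ℕ, 1 ≤ i → i < n →
      ¬∃ x : R ⧸ Submodule.span R {a ^ i},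
        a • x = (Submodule.Quotient.mk 1 : R ⧸ Submodule.span R {a ^ i})) :
    ∀ (i : ℕ) (hi : i < n),
      Nonempty
        ((↥(LinearMap.range (psi a (i + 1) n hi)) ⧸
            Submodule.comap (LinearMap.range (psi a (i + 1) n hi)).subtype
              (LinearMap.range (psi a i n (Nat.le_of_lt hi))))
          ≃ₗ[R] (R ⧸ Submodule.span R {a})) := by
  intro i hi
  set P := LinearMap.range (psi a (i + 1) n hi) with hP
  set Q := LinearMap.range (psi a i n (Nat.le_of_lt hi)) with hQ
  let f : R →ₗ[R] (↥P ⧸ Submodule.comap P.subtype Q) :=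
    (Submodule.comap P.subtype Q).mkQ ∘ₗ
      (psi a (i + 1) n hi).rangeRestrict ∘ₗ (Submodule.span R {a ^ (i + 1)}).mkQ
  have hf : Function.Surjective f :=
    (Submodule.mkQ_surjective _).comp
      ((LinearMap.surjective_rangeRestrict _).comp (Submodule.mkQ_surjective _))
  obtain ⟨k, rfl⟩ : ∃ k, n = k + (i + 1) := ⟨n - (i + 1), by omega⟩
  have e1 : k + (i + 1) - (i + 1) = k := by omega
  have e2 : k + (i + 1) - i = k + 1 := by omega
  have hk : LinearMap.ker f = Submodule.span R {a} := by
    ext r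
    have h0 : r ∈ LinearMap.ker f ↔
        psi a (i + 1) (k + (i + 1)) hi (Submodule.Quotient.mk r) ∈ Q := by
      rw [LinearMap.mem_ker]
      exact Submodule.Quotient.mk_eq_zero _
    rw [h0, psi_mk_aux, e1, Submodule.mem_span_singleton]
    constructor
    · rintro ⟨x, hx⟩
      obtain ⟨s, rfl⟩ := Submodule.Quotient.mk_surjective _ x
      rw [psi_mk_aux, e2, Submodule.Quotient.eq, Submodule.mem_span_singleton] at hx
      obtain ⟨t, ht⟩ := hx
      refine ⟨s - t * a ^ i, ?_⟩
      rw [smul_eq_mul] at ht ⊢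
      rw [← sub_eq_zero]
      apply cancel_aux a h1 k
      have e3 : a ^ (k + (i + 1)) = a ^ i * a * a ^ k := by
        rw [← pow_succ, ← pow_add]; congr 1; omega
      rw [e3, pow_succ'] at ht
      simp only [sub_mul, mul_assoc] at ht ⊢
      rw [ht]
      abel
    · rintro ⟨s, rfl⟩
      refine ⟨Submodule.Quotient.mk s, ?_⟩
      rw [psi_mk_aux, e2, pow_succ', smul_eq_mul, mul_assoc]
  exact ⟨((Submodule.quotEquivOfEq _ _ hk).symm.trans (f.quotKerEquivOfSurjective hf)).symm⟩
end

section
/- Let ε ∈ R be an idempotent (ε² = ε) with R·ε·R = R, and assume: (1) ε·a = a·ε, and (2) a·(1−ε) = u·(1−ε) for some invertible central element u of R. Then ε·a = ε·a·ε lies in the corner ring S = εRε, and ε·a is neither a right zero divisor nor left invertible in S; that is: for every r ∈ R, if (ε·r·ε)·(ε·a) = 0 then ε·r·ε = 0, and there is no r ∈ R with (ε·r·ε)·(ε·a) = ε. -/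
/-- Let `ε ∈ R` be an idempotent with `R·ε·R = R`, and assume `ε·a = a·ε` and
`a·(1−ε) = u·(1−ε)` for some invertible central element `u` of `R`. Then `ε·a = ε·a·ε` lies in
the corner ring `S = εRε`, and `ε·a` is neither a right zero divisor nor left invertible in
`S`: for every `r ∈ R`, if `(ε·r·ε)·(ε·a) = 0` then `ε·r·ε = 0`, and there is no `r ∈ R` with
`(ε·r·ε)·(ε·a) = ε`. -/
theorem stmt_8 {R : Type*} [Ring R] [Nontrivial R] (a : R)
    (h1 : ∀ r : R, r * a = 0 → r = 0)
    (h2 : Submodule.span R {a} ≠ (⊤ : Submodule R R))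
    (ε : R) (hidem : ε ^ 2 = ε)
    (hfull : ∀ x : R, ∃ (m : ℕ) (r s : Fin m → R), x = ∑ k, r k * ε * s k)
    (hcomm : ε * a = a * ε)
    (hu : ∃ u : R, IsUnit u ∧ (∀ r : R, u * r = r * u) ∧ a * (1 - ε) = u * (1 - ε)) :
    ε * a = ε * a * ε ∧
    (∀ r : R, (ε * r * ε) * (ε * a) = 0 → ε * r * ε = 0) ∧
    ¬∃ r : R, (ε * r * ε) * (ε * a) = ε := by
  have he : ε * ε = ε := by rw [← sq, hidem]
  have key : ∀ r : R, (ε * r * ε) * (ε * a) = (ε * r * ε) * a := by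
    intro r
    rw [← mul_assoc, mul_assoc (ε * r) ε ε, he]
  refine ⟨?_, ?_, ?_⟩
  · rw [mul_assoc, ← hcomm, ← mul_assoc, he]
  · intro r hr
    exact h1 _ (by rw [← key, hr])
  · rintro ⟨r, hr⟩
    obtain ⟨u, hunit, -, hau⟩ := hu
    obtain ⟨v, hv⟩ := hunit.exists_left_inv
    apply h2
    apply (Ideal.eq_top_iff_one (Ideal.span {a})).2
    refine Ideal.mem_span_singleton'.2 ⟨ε * r * ε + v * (1 - ε), ?_⟩
    have hc : (1 - ε) * a = a * (1 - ε) := by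
      rw [sub_mul, mul_sub, hcomm, one_mul, mul_one]
    rw [add_mul, ← key, hr, mul_assoc, hc, hau, ← mul_assoc, hv, one_mul]
    abel
end

section
/- Let ε ∈ R be an idempotent (ε² = ε) with R·ε·R = R, and assume: (1) ε·a = a·ε, and (2) a·(1−ε) = u·(1−ε) for some invertible central element u of R. Then for every n ≥ 1: (a) for every r ∈ R one has ε·r − ε·r·ε ∈ R·a^n; and (b) for every r ∈ R, ε·r·ε ∈ R·a^n if and only if ε·r·ε = (ε·r'·ε)·(ε·a)^n for some r' ∈ R. Consequently the map ν_n sending ε·r·ε + S·(ε·a)^n to ε·r·ε + R·a^n is an isomorphism of left S-modules from S/S·(ε·a)^n onto ε·(R/R·a^n), where S = εRε. -/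
/-- Let `ε ∈ R` be an idempotent with `R·ε·R = R`, and assume `ε·a = a·ε` and
`a·(1−ε) = u·(1−ε)` for some invertible central element `u` of `R`. Then for every `n ≥ 1`:
(a) for every `r ∈ R`, `ε·r − ε·r·ε ∈ R·a^n`; and
(b) for every `r ∈ R`, `ε·r·ε ∈ R·a^n` iff `ε·r·ε = (ε·r'·ε)·(ε·a)^n` for some `r' ∈ R`
(i.e. iff `ε·r·ε ∈ S·(ε·a)^n` where `S = εRε`).
Consequently the map `ν_n : ε·r·ε + S·(ε·a)^n ↦ ε·r·ε + R·a^n` is an isomorphism of left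
`S`-modules from `S/S·(ε·a)^n` onto `ε·(R/R·a^n)`; concretely, it is
(c) well defined and injective: `ε·r·ε` and `ε·r'·ε` have the same image in `R/R·a^n` iff
their difference lies in `S·(ε·a)^n`; and
(d) surjective onto `ε·(R/R·a^n)`: every element of the form `ε • q`, `q ∈ R/R·a^n`, is the
class of some `ε·r·ε`. -/
theorem stmt_9 {R : Type*} [Ring R] [Nontrivial R] (a : R)
    (h1 : ∀ r : R, r * a = 0 → r = 0)
    (h2 : Submodule.span R {a} ≠ (⊤ : Submodule R R))
    (ε : R) (hidem : ε ^ 2 = ε)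
    (hfull : ∀ x : R, ∃ (m : ℕ) (r s : Fin m → R), x = ∑ k, r k * ε * s k)
    (hcomm : ε * a = a * ε)
    (hu : ∃ u : R, IsUnit u ∧ (∀ r : R, u * r = r * u) ∧ a * (1 - ε) = u * (1 - ε)) :
    ∀ n : ℕ, 1 ≤ n →
      (∀ r : R, ε * r - ε * r * ε ∈ Submodule.span R {a ^ n}) ∧
      (∀ r : R, ε * r * ε ∈ Submodule.span R {a ^ n} ↔
        ∃ r' : R, ε * r * ε = (ε * r' * ε) * (ε * a) ^ n) ∧
      (∀ r r' : R,
        (Submodule.Quotient.mk (ε * r * ε) : R ⧸ Submodule.span R {a ^ n}) =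
            Submodule.Quotient.mk (ε * r' * ε) ↔
          ∃ s : R, ε * r * ε - ε * r' * ε = (ε * s * ε) * (ε * a) ^ n) ∧
      (∀ q : R ⧸ Submodule.span R {a ^ n},
        ∃ r : R, ε • q = (Submodule.Quotient.mk (ε * r * ε) : R ⧸ Submodule.span R {a ^ n})) := by
  obtain ⟨u, ⟨w, rfl⟩, hcen, hau⟩ := hu
  have hee : ε * ε = ε := by rw [← sq]; exact hidem
  intro n _
  have hcn : ε * a ^ n = a ^ n * ε := (show Commute ε a from hcomm).pow_right n
  have hpow : ∀ k : ℕ, a ^ k * (1 - ε) = (w : R) ^ k * (1 - ε) := by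
    intro k
    induction k with
    | zero => simp
    | succ k ih =>
      have hk : (w : R) * a ^ k = a ^ k * w := hcen _
      rw [pow_succ, mul_assoc, hau, ← mul_assoc, ← hk, mul_assoc, ih, ← mul_assoc, pow_succ']
  have hkey : ∀ y : R, y * (1 - ε) ∈ Submodule.span R {a ^ n} := by
    intro y
    refine Submodule.mem_span_singleton.2 ⟨y * ((w⁻¹ ^ n : Rˣ) : R) * (1 - ε), ?_⟩
    have hc : (1 - ε) * a ^ n = a ^ n * (1 - ε) := by
      rw [sub_mul, mul_sub, hcn, one_mul, mul_one]
    have hi : ((w⁻¹ ^ n : Rˣ) : R) * (w : R) ^ n = 1 := by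
      rw [← Units.val_pow_eq_pow_val, ← Units.val_mul]; simp
    rw [smul_eq_mul, mul_assoc, hc, hpow, mul_assoc, ← mul_assoc _ ((w : R) ^ n), hi, one_mul]
  have hA : ∀ r : R, ε * r - ε * r * ε ∈ Submodule.span R {a ^ n} := by
    intro r
    have := hkey (ε * r)
    rwa [mul_sub, mul_one] at this
  have hea : ∀ x : R, (ε * x * ε) * (ε * a) ^ n = (ε * x * ε) * a ^ n := by
    intro x
    have : ∀ k : ℕ, ε * (ε * a) ^ k = ε * a ^ k := by
      intro k
      induction k with
      | zero => simp
      | succ k ih =>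
        have hck : ε * a ^ k = a ^ k * ε := (show Commute ε a from hcomm).pow_right k
        rw [pow_succ, ← mul_assoc, ih, hck, mul_assoc, ← mul_assoc ε ε, hee, ← mul_assoc, ← hck,
          mul_assoc, ← pow_succ]
    rw [mul_assoc, this, ← mul_assoc]
  have hB : ∀ r : R, ε * r * ε ∈ Submodule.span R {a ^ n} ↔
        ∃ r' : R, ε * r * ε = (ε * r' * ε) * (ε * a) ^ n := by
    intro r
    rw [Submodule.mem_span_singleton]
    constructor
    · rintro ⟨x, hx⟩
      refine ⟨x, ?_⟩
      rw [hea, mul_assoc (ε * x), hcn]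
      have h : ε * (ε * r * ε) * ε = ε * r * ε := by
        rw [mul_assoc ε r, ← mul_assoc ε ε, hee, mul_assoc, mul_assoc r, hee]
      rw [← h, ← hx, smul_eq_mul]
      simp only [mul_assoc]
    · rintro ⟨x, hx⟩
      exact ⟨ε * x * ε, by rw [hx, hea, smul_eq_mul]⟩
  refine ⟨hA, hB, ?_, ?_⟩
  · intro r r'
    rw [Submodule.Quotient.eq, ← sub_mul, ← mul_sub]
    exact hB _
  · intro q
    obtain ⟨r, rfl⟩ := Submodule.Quotient.mk_surjective _ q
    refine ⟨r, ?_⟩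
    rw [← Submodule.Quotient.mk_smul, Submodule.Quotient.eq]
    exact hA r
end

section
/- The Prüfer module U over K[x,x⁻¹] is divisible by every nonzero ring element: for every ℓ ∈ K[x,x⁻¹] with ℓ ≠ 0 and every u ∈ U, there exists v ∈ U with ℓ·v = u. -/
/-- The Prüfer module `U` over `K[x,x⁻¹]`: the direct limit of the modules
`M_n = K[x,x⁻¹]/((x−1)^n)`, `n ≥ 1`, with transition maps sending `r + ((x−1)^i)` to
`r(x−1)^{ℓ−i} + ((x−1)^ℓ)`, realized as the direct limit over `n : ℕ` of `M_{n+1}`.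
(Here `x = T 1`.) -/
noncomputable abbrev laurentPruefer (K : Type*) [Field K] : Type _ :=
  Module.DirectLimit
    (fun n : ℕ => LaurentPolynomial K ⧸
      Submodule.span (LaurentPolynomial K) {(LaurentPolynomial.T 1 - 1) ^ (n + 1)})
    (fun i j h => psi (LaurentPolynomial.T 1 - 1) (i + 1) (j + 1) (Nat.succ_le_succ h))

theorem laurent_key {K : Type*} [Field K] (l : LaurentPolynomial K) (hl : l ≠ 0) (n : ℕ) :
    ∃ (k : ℕ) (w p : LaurentPolynomial K),
      l * w = (LaurentPolynomial.T 1 - 1) ^ k - (LaurentPolynomial.T 1 - 1) ^ (k + n) * p := by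
  obtain ⟨N, f, hf⟩ := LaurentPolynomial.exists_T_pow l
  have hf0 : f ≠ 0 := by
    rintro rfl
    rw [map_zero] at hf
    exact hl ((LaurentPolynomial.isUnit_T (R := K) N).mul_left_eq_zero.mp hf.symm)
  obtain ⟨g, hg, hnd⟩ := Polynomial.exists_eq_pow_rootMultiplicity_mul_and_not_dvd f hf0 (1 : K)
  have hc : IsCoprime ((Polynomial.X - Polynomial.C (1 : K)) ^ n) g :=
    (((Polynomial.irreducible_X_sub_C (1 : K)).coprime_iff_not_dvd).2 hnd).pow_left
  obtain ⟨p, q, hpq⟩ := hc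
  have h1 := congrArg (Polynomial.toLaurent (R := K)) hg
  have h2 := congrArg (Polynomial.toLaurent (R := K)) hpq
  simp only [map_mul, map_pow, map_sub, map_add, map_one, Polynomial.toLaurent_X] at h1 h2
  refine ⟨Polynomial.rootMultiplicity 1 f, LaurentPolynomial.T N * Polynomial.toLaurent q, Polynomial.toLaurent p, ?_⟩
  · rw [← mul_assoc, ← hf, h1, pow_add]
    linear_combination (LaurentPolynomial.T 1 - 1) ^ (Polynomial.rootMultiplicity 1 f) * h2

/-- The Prüfer module `U` over `K[x,x⁻¹]` is divisible by every nonzero ring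
element: for every `ℓ ∈ K[x,x⁻¹]` with `ℓ ≠ 0` and every `u ∈ U`, there exists `v ∈ U` with
`ℓ·v = u`. -/
theorem stmt_15 {K : Type*} [Field K] (ℓ : LaurentPolynomial K) (hℓ : ℓ ≠ 0)
    (u : laurentPruefer K) : ∃ v : laurentPruefer K, ℓ • v = u := by
  obtain ⟨n, m, rfl⟩ := Module.DirectLimit.exists_of u
  obtain ⟨r, rfl⟩ := Submodule.Quotient.mk_surjective _ m
  obtain ⟨k, w, p, h⟩ := laurent_key ℓ hℓ (n + 1)
  refine ⟨Module.DirectLimit.of _ _ _ _ (n + k) (Submodule.Quotient.mk (w * r)), ?_⟩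
  rw [← map_smul, ← Module.DirectLimit.of_f (hij := Nat.le_add_right n k)]
  congr 1
  change Submodule.Quotient.mk (ℓ • (w * r)) = Submodule.Quotient.mk (r • _ ^ (n + k + 1 - (n + 1)))
  rw [Submodule.Quotient.eq, Submodule.mem_span_singleton]
  refine ⟨-(p * r), ?_⟩
  have e : n + k + 1 - (n + 1) = k := by omega
  have e2 : n + k + 1 = k + (n + 1) := by omega
  rw [e, e2]
  simp only [smul_eq_mul]
  linear_combination (-r) * h
end

section
/- The Prüfer module U over K[x,x⁻¹] is an injective K[x,x⁻¹]-module; equivalently (by Baer's criterion), for every ideal I of K[x,x⁻¹], every K[x,x⁻¹]-module homomorphism I → U extends to a homomorphism K[x,x⁻¹] → U. -/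
theorem laurent_isDomain (K : Type*) [Field K] : IsDomain (LaurentPolynomial K) := by
  have : NoZeroDivisors (LaurentPolynomial K) :=
    inferInstanceAs (NoZeroDivisors (AddMonoidAlgebra K ℤ))
  have : Nontrivial (LaurentPolynomial K) :=
    inferInstanceAs (Nontrivial (AddMonoidAlgebra K ℤ))
  exact NoZeroDivisors.to_isDomain _

theorem laurent_isPID (K : Type*) [Field K] : IsPrincipalIdealRing (LaurentPolynomial K) := by
  refine ⟨fun I => ?_⟩
  have h := IsLocalization.map_under (Submonoid.powers (Polynomial.X : Polynomial K))
    (LaurentPolynomial K) I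
  obtain ⟨g, hg⟩ := IsPrincipalIdealRing.principal
    (I.under (Polynomial K))
  refine ⟨algebraMap (Polynomial K) (LaurentPolynomial K) g, ?_⟩
  rw [hg, Ideal.submodule_span_eq, Ideal.map_span, Set.image_singleton] at h
  exact h.symm

theorem pruefer_smul_base (K : Type*) [Field K] (u : laurentPruefer K) :
    ∃ v : laurentPruefer K, (LaurentPolynomial.T 1 - 1 : LaurentPolynomial K) • v = u := by
  obtain ⟨i, x, rfl⟩ := Module.DirectLimit.exists_of u
  obtain ⟨r, rfl⟩ := Submodule.Quotient.mk_surjective _ x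
  refine ⟨Module.DirectLimit.of _ _ _ _ (i + 1) (Submodule.Quotient.mk r), ?_⟩
  rw [← Module.DirectLimit.of_f (hij := Nat.le_succ i), ← map_smul]
  congr 1
  refine congrArg (Submodule.Quotient.mk (p := Submodule.span (LaurentPolynomial K)
    {(LaurentPolynomial.T 1 - 1 : LaurentPolynomial K) ^ (i + 1 + 1)}))
    (?_ : (LaurentPolynomial.T 1 - 1 : LaurentPolynomial K) * r
      = r * (LaurentPolynomial.T 1 - 1 : LaurentPolynomial K) ^ (i + 1 + 1 - (i + 1)))
  rw [Nat.add_sub_cancel_left, pow_one, mul_comm]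

theorem pruefer_tors (K : Type*) [Field K] (u : laurentPruefer K) :
    ∃ n : ℕ, ((LaurentPolynomial.T 1 - 1 : LaurentPolynomial K) ^ n) • u = 0 := by
  obtain ⟨i, x, rfl⟩ := Module.DirectLimit.exists_of u
  obtain ⟨r, rfl⟩ := Submodule.Quotient.mk_surjective _ x
  refine ⟨i + 1, ?_⟩
  rw [← map_smul, ← Submodule.Quotient.mk_smul, (Submodule.Quotient.mk_eq_zero _).2, map_zero]
  rw [smul_eq_mul, mul_comm, ← smul_eq_mul]
  exact Submodule.smul_mem _ _ (Submodule.mem_span_singleton_self _)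

theorem pruefer_div (K : Type*) [Field K] (r : LaurentPolynomial K) (hr : r ≠ 0) :
    ∀ u : laurentPruefer K, ∃ v : laurentPruefer K, r • v = u := by
  have := laurent_isDomain K
  have := laurent_isPID K
  induction r using UniqueFactorizationMonoid.induction_on_prime with
  | h₁ => exact absurd rfl hr
  | h₂ x hx =>
    intro u
    obtain ⟨y, hy⟩ := hx.exists_right_inv
    exact ⟨y • u, by rw [smul_smul, hy, one_smul]⟩
  | h₃ b p hb hp ih =>
    intro u
    have key : ∃ w : laurentPruefer K, p • w = u := by
      by_cases hd : p ∣ (LaurentPolynomial.T 1 - 1 : LaurentPolynomial K)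
      · obtain ⟨q, hq⟩ := hd
        obtain ⟨v, hv⟩ := pruefer_smul_base K u
        exact ⟨q • v, by rw [smul_smul, ← hq, hv]⟩
      · obtain ⟨n, hn⟩ := pruefer_tors K u
        have hc : IsCoprime p ((LaurentPolynomial.T 1 - 1 : LaurentPolynomial K) ^ n) :=
          ((hp.irreducible.coprime_iff_not_dvd).2 hd).pow_right
        obtain ⟨c, d, hcd⟩ := hc
        refine ⟨c • u, ?_⟩
        calc p • c • u = (c * p) • u + d • (LaurentPolynomial.T 1 - 1 : LaurentPolynomial K) ^ n • u := by
              rw [hn, smul_zero, add_zero, smul_smul, mul_comm]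
          _ = u := by rw [smul_smul, ← add_smul, hcd, one_smul]
    obtain ⟨w, hw⟩ := key
    obtain ⟨v, hv⟩ := ih hb w
    exact ⟨v, by rw [mul_smul, hv, hw]⟩

theorem pruefer_baer (K : Type*) [Field K] :
    Module.Baer (LaurentPolynomial K) (laurentPruefer K) := by
  intro I f
  have := laurent_isPID K
  obtain ⟨g, rfl⟩ := IsPrincipalIdealRing.principal I
  have hg : g ∈ Submodule.span (LaurentPolynomial K) {g} := Submodule.mem_span_singleton_self _
  obtain ⟨v, hv⟩ : ∃ v : laurentPruefer K, g • v = f ⟨g, hg⟩ := by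
    by_cases h0 : g = 0
    · subst h0
      refine ⟨0, ?_⟩
      rw [smul_zero]
      exact (map_zero f).symm
    · exact pruefer_div K g h0 _
  refine ⟨LinearMap.toSpanSingleton _ _ v, ?_⟩
  intro x hx
  obtain ⟨c, rfl⟩ := Submodule.mem_span_singleton.1 hx
  rw [LinearMap.toSpanSingleton_apply, smul_assoc, hv, ← map_smul]
  rfl

/-- The Prüfer module `U` over `K[x,x⁻¹]` is an injective `K[x,x⁻¹]`-module;
equivalently (by Baer's criterion), every module homomorphism from an ideal of `K[x,x⁻¹]`
to `U` extends to the whole ring. -/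
theorem stmt_16 {K : Type*} [Field K] :
    Module.Injective (LaurentPolynomial K) (laurentPruefer K) ∧
    Module.Baer (LaurentPolynomial K) (laurentPruefer K) := by
  exact ⟨(pruefer_baer K).injective, pruefer_baer K⟩
end
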